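/- arXiv:2111.08122 — 2 statements merged into one kernel-verified Lean document; each statement's English description precedes it below -/
import Mathlib

section
/- If L is a finite semidistrim lattice and u ≤ v in L, then the interval [u, v] (as a lattice in its own right) is semidistrim. -/
universe u

/-- An element of a lattice is join-irreducible if it covers exactly one element. -/
def JoinIrred {α : Type u} [Lattice α] (j : α) : Prop := ∃! y : α, y ⋖ j

/-- An element of a lattice is meet-irreducible if it is covered by exactly one element. -/
def MeetIrred {α : Type u} [Lattice α] (m : α) : Prop := ∃! y : α, m ⋖ y

/-- `j` is join-prime if `j ≤ x ⊔ y` implies `j ≤ x` or `j ≤ y`. -/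
def JoinPrime {α : Type u} [Lattice α] (j : α) : Prop :=
  ∀ x y : α, j ≤ x ⊔ y → j ≤ x ∨ j ≤ y

/-- `m` is meet-prime if `x ⊓ y ≤ m` implies `x ≤ m` or `y ≤ m`. -/
def MeetPrime {α : Type u} [Lattice α] (m : α) : Prop :=
  ∀ x y : α, x ⊓ y ≤ m → x ≤ m ∨ y ≤ m

/-- `(j0, m0)` is a prime pair: the lattice is the disjoint union of `[⊥, m0]` and `[j0, ⊤]`,
i.e. every element satisfies exactly one of `z ≤ m0` or `j0 ≤ z`. -/
def IsPrimePair {α : Type u} [Lattice α] (j0 m0 : α) : Prop :=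
  ∀ z : α, (z ≤ m0 ∨ j0 ≤ z) ∧ ¬(z ≤ m0 ∧ j0 ≤ z)

/-- A pairing is a bijection `κ` from join-irreducibles to meet-irreducibles such that
`κ j` is maximal in `{z | j ⊓ z = j_*}` and `j = κ⁻¹ (κ j)` is minimal in
`{z | κ j ⊔ z = (κ j)^*}`. -/
def IsPairing {α : Type u} [Lattice α]
    (κ : {j : α // JoinIrred j} → {m : α // MeetIrred m}) : Prop :=
  Function.Bijective κ ∧
    (∀ (j : {j : α // JoinIrred j}) (jst : α), jst ⋖ j.1 →
      Maximal (fun z : α => j.1 ⊓ z = jst) (κ j).1) ∧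
    (∀ (j : {j : α // JoinIrred j}) (mst : α), (κ j).1 ⋖ mst →
      Minimal (fun z : α => (κ j).1 ⊔ z = mst) j.1)

/-- The edge relation of the Galois graph: `j → j'` iff `j ≠ j'` and `j ≰ κ j'`. -/
def GaloisEdge {α : Type u} [Lattice α]
    (κ : {j : α // JoinIrred j} → {m : α // MeetIrred m})
    (j j' : {j : α // JoinIrred j}) : Prop :=
  j ≠ j' ∧ ¬ j.1 ≤ (κ j').1

/-- Independent sets of the Galois graph (no edge in either direction). -/
def IndepSet {α : Type u} [Lattice α]
    (κ : {j : α // JoinIrred j} → {m : α // MeetIrred m})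
    (S : Set {j : α // JoinIrred j}) : Prop :=
  ∀ j ∈ S, ∀ j' ∈ S, ¬ GaloisEdge κ j j'

/-- The downward label set `D_L(x)`: labels of the cover relations `y ⋖ x`. -/
def DLabel {α : Type u} [Lattice α]
    (κ : {j : α // JoinIrred j} → {m : α // MeetIrred m}) (x : α) :
    Set {j : α // JoinIrred j} :=
  {j | ∃ y : α, y ⋖ x ∧ j.1 ≤ x ∧ y ≤ (κ j).1}

/-- The upward label set `U_L(x)`: labels of the cover relations `x ⋖ y`. -/
def ULabel {α : Type u} [Lattice α]
    (κ : {j : α // JoinIrred j} → {m : α // MeetIrred m}) (x : α) :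
    Set {j : α // JoinIrred j} :=
  {j | ∃ y : α, x ⋖ y ∧ j.1 ≤ y ∧ x ≤ (κ j).1}

/-- A uniquely paired lattice is overlapping if every cover relation has a unique label. -/
def Overlapping {α : Type u} [Lattice α]
    (κ : {j : α // JoinIrred j} → {m : α // MeetIrred m}) : Prop :=
  ∀ x y : α, x ⋖ y → ∃! j : {j : α // JoinIrred j}, j.1 ≤ y ∧ x ≤ (κ j).1

/-- Compatibly dismantlable lattices: either a one-element lattice, or a uniquely paired
lattice with a prime pair `(j0, m0)` whose intervals `[j0, ⊤] = Set.Ici j0` and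
`[⊥, m0] = Set.Iic m0` are compatibly dismantlable, together with the compatibility
conditions relating the unique pairings via `α j = j0 ⊔ j` and `β m = m0 ⊓ m`. -/
inductive CompatiblyDismantlable : (β : Type u) → [Lattice β] → [Finite β] → Prop
  | singleton (β : Type u) [Lattice β] [Finite β] (h : Nat.card β = 1) :
      CompatiblyDismantlable β
  | step (β : Type u) [Lattice β] [Finite β]
      (κ : {j : β // JoinIrred j} → {m : β // MeetIrred m})
      (hκ : IsPairing κ) (huniq : ∀ κ', IsPairing κ' → κ' = κ)
      (j0 m0 : β) (hpp : IsPrimePair j0 m0)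
      (hup : CompatiblyDismantlable ↥(Set.Ici j0))
      (hdn : CompatiblyDismantlable ↥(Set.Iic m0))
      (κup : {j : ↥(Set.Ici j0) // JoinIrred j} → {m : ↥(Set.Ici j0) // MeetIrred m})
      (hκup : IsPairing κup) (hκupuniq : ∀ κ', IsPairing κ' → κ' = κup)
      (κdn : {j : ↥(Set.Iic m0) // JoinIrred j} → {m : ↥(Set.Iic m0) // MeetIrred m})
      (hκdn : IsPairing κdn) (hκdnuniq : ∀ κ', IsPairing κ' → κ' = κdn)
      (halpha : ∀ j : {j : β // JoinIrred j}, j0 ≤ (κ j).1 →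
          ∃ hji : JoinIrred (⟨j0 ⊔ j.1, Set.mem_Ici.mpr le_sup_left⟩ : ↥(Set.Ici j0)),
            (κup ⟨⟨j0 ⊔ j.1, Set.mem_Ici.mpr le_sup_left⟩, hji⟩).1.1 = (κ j).1)
      (halphainj : ∀ j j' : {j : β // JoinIrred j}, j0 ≤ (κ j).1 → j0 ≤ (κ j').1 →
          j0 ⊔ j.1 = j0 ⊔ j'.1 → j = j')
      (halphasurj : ∀ j' : {j : ↥(Set.Ici j0) // JoinIrred j},
          ∃ j : {j : β // JoinIrred j}, j0 ≤ (κ j).1 ∧ j0 ⊔ j.1 = j'.1.1)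
      (hbeta : ∀ (j : {j : β // JoinIrred j}) (h : j.1 ≤ m0),
          ∃ hji : JoinIrred (⟨j.1, Set.mem_Iic.mpr h⟩ : ↥(Set.Iic m0)),
            (κdn ⟨⟨j.1, Set.mem_Iic.mpr h⟩, hji⟩).1.1 = m0 ⊓ (κ j).1)
      (hbetainj : ∀ j j' : {j : β // JoinIrred j}, j.1 ≤ m0 → j'.1 ≤ m0 →
          m0 ⊓ (κ j).1 = m0 ⊓ (κ j').1 → j = j')
      (hbetasurj : ∀ m' : {m : ↥(Set.Iic m0) // MeetIrred m},
          ∃ j : {j : β // JoinIrred j}, j.1 ≤ m0 ∧ m0 ⊓ (κ j).1 = m'.1.1) :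
      CompatiblyDismantlable β

/-- A lattice is semidistrim if it is compatibly dismantlable and the downward and upward
label sets of every element are independent sets of the Galois graph. -/
def Semidistrim (β : Type u) [Lattice β] [Finite β] : Prop :=
  CompatiblyDismantlable β ∧
    ∀ κ : {j : β // JoinIrred j} → {m : β // MeetIrred m}, IsPairing κ →
      ∀ x : β, IndepSet κ (DLabel κ x) ∧ IndepSet κ (ULabel κ x)

section Helpers

structure IsMatch {α : Type u} [Lattice α] (P : α → α → Prop) : Prop where
  ji : ∀ {j m}, P j m → JoinIrred j
  mi : ∀ {j m}, P j m → MeetIrred m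
  nle : ∀ {j m}, P j m → ¬ j ≤ m
  lo : ∀ {j m y}, P j m → y ⋖ j → y ≤ m
  hi : ∀ {j m z}, P j m → m ⋖ z → j ≤ z
  exm : ∀ {j}, JoinIrred j → ∃ m, P j m
  exj : ∀ {m}, MeetIrred m → ∃ j, P j m
  um : ∀ {j m m'}, P j m → P j m' → m = m'
  uj : ∀ {j j' m}, P j m → P j' m → j = j'

structure Emb {α γ : Type u} [Lattice α] [Lattice γ] (f : γ → α) (u v : α) : Prop where
  le : ∀ {x y}, f x ≤ f y ↔ x ≤ y
  lo : ∀ x, u ≤ f x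
  hi : ∀ x, f x ≤ v
  surj : ∀ {a}, u ≤ a → a ≤ v → ∃ x, f x = a

structure Good {α γ : Type u} [Lattice α] [Lattice γ] (P : α → α → Prop)
    (f : γ → α) (u v : α) : Prop where
  J1 : ∀ {j m x}, P j m → j ≤ v → u ≤ m → f x = u ⊔ j → JoinIrred x ∧ ∀ y, y ⋖ x → f y ≤ m
  J2 : ∀ {x}, JoinIrred x → ∃ j m, P j m ∧ j ≤ v ∧ u ≤ m ∧ f x = u ⊔ j
  J3 : ∀ {j m j' m'}, P j m → P j' m' → j ≤ v → u ≤ m → j' ≤ v → u ≤ m' → u ⊔ j = u ⊔ j' → j = j'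
  M1 : ∀ {j m x}, P j m → j ≤ v → u ≤ m → f x = v ⊓ m → MeetIrred x ∧ ∀ y, x ⋖ y → j ≤ f y
  M2 : ∀ {x}, MeetIrred x → ∃ j m, P j m ∧ j ≤ v ∧ u ≤ m ∧ f x = v ⊓ m
  M3 : ∀ {j m j' m'}, P j m → P j' m' → j ≤ v → u ≤ m → j' ≤ v → u ≤ m' → v ⊓ m = v ⊓ m' → m = m'

def DInd {α : Type u} [Lattice α] (P : α → α → Prop) : Prop :=
  ∀ {x y y' j m j' m'}, P j m → P j' m' → y ⋖ x → y' ⋖ x → j ≤ x → j' ≤ x → y ≤ m → y' ≤ m' →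
    j ≠ j' → j ≤ m'

def UInd {α : Type u} [Lattice α] (P : α → α → Prop) : Prop :=
  ∀ {x y y' j m j' m'}, P j m → P j' m' → x ⋖ y → x ⋖ y' → j ≤ y → j' ≤ y' → x ≤ m → x ≤ m' →
    j ≠ j' → j ≤ m'

def RelK {α : Type u} [Lattice α]
    (κ : {j : α // JoinIrred j} → {m : α // MeetIrred m}) (j m : α) : Prop :=
  ∃ hj : JoinIrred j, (κ ⟨j, hj⟩).1 = m

def IndQ {α γ : Type u} [Lattice α] [Lattice γ] (P : α → α → Prop)
    (f : γ → α) (u v : α) (x y : γ) : Prop :=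
  ∃ j m, P j m ∧ j ≤ v ∧ u ≤ m ∧ f x = u ⊔ j ∧ f y = v ⊓ m

variable {α β γ : Type u} [Lattice α] [Lattice β] [Lattice γ]

theorem exCovL [Finite α] {a b : α} (h : a < b) : ∃ y, a ≤ y ∧ y ⋖ b := by
  obtain ⟨y, hy, hy2⟩ := exists_le_covBy_of_lt h
  exact ⟨y, hy, hy2⟩

theorem exCovU [Finite α] {a b : α} (h : a < b) : ∃ y, a ⋖ y ∧ y ≤ b := by
  obtain ⟨y, hy, hy2⟩ := exists_covBy_le_of_lt h
  exact ⟨y, hy, hy2⟩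

theorem ji_of {x t : α} (h : t < x) (h2 : ∀ y, y < x → y ≤ t) : JoinIrred x := by
  refine ⟨t, ⟨h, fun c hc hcx => ?_⟩, fun y hy => ?_⟩
  · exact absurd (h2 c hcx) (not_le_of_gt hc)
  · rcases (h2 y hy.lt).lt_or_eq with h3 | h3
    · exact absurd h (hy.2 h3)
    · exact h3

theorem mi_of {x t : α} (h : x < t) (h2 : ∀ y, x < y → t ≤ y) : MeetIrred x := by
  refine ⟨t, ⟨h, fun c hc hcx => ?_⟩, fun y hy => ?_⟩
  · exact absurd (h2 c hc) (not_le_of_gt hcx)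
  · rcases (h2 y hy.lt).lt_or_eq with h3 | h3
    · exact absurd h3 (hy.2 h)
    · exact h3.symm

theorem ji_sup [Finite α] {x p q : α} (h : JoinIrred x) (hp : p < x) (hq : q < x) : p ⊔ q < x := by
  obtain ⟨t, ht, hu⟩ := h
  obtain ⟨a, ha, ha2⟩ := exCovL hp
  obtain ⟨b, hb, hb2⟩ := exCovL hq
  obtain rfl := hu a ha2
  obtain rfl := hu b hb2
  exact lt_of_le_of_lt (sup_le ha hb) ht.lt

theorem mi_inf [Finite α] {x p q : α} (h : MeetIrred x) (hp : x < p) (hq : x < q) : x < p ⊓ q := by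
  obtain ⟨t, ht, hu⟩ := h
  obtain ⟨a, ha, ha2⟩ := exCovU hp
  obtain ⟨b, hb, hb2⟩ := exCovU hq
  obtain rfl := hu a ha
  obtain rfl := hu b hb
  exact lt_of_lt_of_le ht.lt (le_inf ha2 hb2)

theorem toMatch {κ : {j : α // JoinIrred j} → {m : α // MeetIrred m}} (h : IsPairing κ) :
    IsMatch (RelK κ) := by
  obtain ⟨hb, h1, h2⟩ := h
  refine ⟨?_, ?_, ?_, ?_, ?_, ?_, ?_, ?_, ?_⟩
  · rintro j m ⟨hj, rfl⟩; exact hj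
  · rintro j m ⟨hj, rfl⟩; exact (κ _).2
  · rintro j m ⟨hj, rfl⟩ hle
    obtain ⟨t, ht, _⟩ := id hj
    have := (h1 ⟨j, hj⟩ t ht).1
    simp only [inf_eq_left.2 hle] at this
    exact ht.lt.ne this.symm
  · rintro j m y ⟨hj, rfl⟩ hy
    have := (h1 ⟨j, hj⟩ y hy).1
    simp only at this
    rw [← this]; exact inf_le_right
  · rintro j m y ⟨hj, rfl⟩ hy
    have := (h2 ⟨j, hj⟩ y hy).1
    simp only at this
    rw [← this]; exact le_sup_right
  · intro j hj; exact ⟨_, hj, rfl⟩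
  · intro m hm
    obtain ⟨⟨j, hj⟩, h⟩ := hb.2 ⟨m, hm⟩
    exact ⟨j, hj, by rw [h]⟩
  · rintro j m m' ⟨hj, rfl⟩ ⟨_, rfl⟩; rfl
  · rintro j j' m ⟨hj, rfl⟩ ⟨hj', h⟩
    have := hb.1 (Subtype.ext h)
    exact (congrArg Subtype.val this).symm

theorem ofMatch [Finite α] {P : α → α → Prop} (h : IsMatch P) :
    ∃ κ : {j : α // JoinIrred j} → {m : α // MeetIrred m}, IsPairing κ ∧ ∀ j, P j.1 (κ j).1 := by
  choose k hk using fun j : {j : α // JoinIrred j} => h.exm j.2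
  refine ⟨fun j => ⟨k j, h.mi (hk j)⟩, ⟨⟨?_, ?_⟩, ?_, ?_⟩, hk⟩
  · intro j j' e
    have e' : k j = k j' := congrArg Subtype.val e
    exact Subtype.ext (h.uj (hk j) (e' ▸ hk j'))
  · rintro ⟨m, hm⟩
    obtain ⟨j, hj⟩ := h.exj hm
    exact ⟨⟨j, h.ji hj⟩, Subtype.ext (h.um (hk ⟨j, h.ji hj⟩) hj)⟩
  · intro j t ht
    have hlt : j.1 ⊓ k j < j.1 := lt_of_le_of_ne inf_le_left
      (fun e => h.nle (hk j) (inf_eq_left.1 e))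
    refine ⟨?_, ?_⟩
    · apply le_antisymm
      · obtain ⟨y, hy, hy2⟩ := exCovL hlt
        rw [j.2.unique ht hy2]; exact hy
      · exact le_inf ht.le (h.lo (hk j) ht)
    · intro z hz hle
      by_contra hc
      obtain ⟨y, hy, hy2⟩ := exCovU (lt_of_le_not_ge hle hc)
      have := (h.hi (hk j) hy).trans hy2
      rw [inf_eq_left.2 this] at hz
      exact ht.lt.ne hz.symm
  · intro j t ht
    have hlt : k j < k j ⊔ j.1 := lt_of_le_of_ne le_sup_left
      (fun e => h.nle (hk j) (sup_eq_left.1 e.symm))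
    refine ⟨?_, ?_⟩
    · apply le_antisymm
      · exact sup_le ht.le (h.hi (hk j) ht)
      · obtain ⟨y, hy, hy2⟩ := exCovU hlt
        rw [(h.mi (hk j)).unique ht hy]; exact hy2
    · intro z hz hle
      by_contra hc
      obtain ⟨y, hy, hy2⟩ := exCovL (lt_of_le_not_ge hle hc)
      have := hy.trans (h.lo (hk j) hy2)
      rw [sup_eq_left.2 this] at hz
      exact ht.lt.ne hz

theorem relK_le {κ : {j : α // JoinIrred j} → {m : α // MeetIrred m}}
    (hu : ∀ κ', IsPairing κ' → κ' = κ) [Finite α] {P : α → α → Prop} (h : IsMatch P) {j m : α}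
    (hP : P j m) : RelK κ j m := by
  obtain ⟨κ', h1, h2⟩ := ofMatch h
  obtain rfl := hu κ' h1
  exact ⟨h.ji hP, h.um (h2 _) hP⟩

theorem match_ge {P Q : α → α → Prop} (hP : IsMatch P) (hQ : IsMatch Q)
    (h : ∀ j m, P j m → Q j m) {j m : α} (hq : Q j m) : P j m := by
  obtain ⟨m', hm'⟩ := hP.exm (hQ.ji hq)
  rwa [hQ.um hq (h _ _ hm')]

theorem Emb.inj {f : γ → α} {u v : α} (e : Emb f u v) {x y : γ} (h : f x = f y) : x = y :=
  le_antisymm (e.le.1 h.le) (e.le.1 h.ge)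

theorem Emb.lt {f : γ → α} {u v : α} (e : Emb f u v) {x y : γ} : f x < f y ↔ x < y := by
  rw [lt_iff_le_not_ge, lt_iff_le_not_ge, e.le, e.le]

theorem Emb.cov {f : γ → α} {u v : α} (e : Emb f u v) {x y : γ} : f x ⋖ f y ↔ x ⋖ y := by
  constructor
  · intro h
    exact ⟨e.lt.1 h.1, fun c h1 h2 => h.2 (e.lt.2 h1) (e.lt.2 h2)⟩
  · intro h
    refine ⟨e.lt.2 h.1, fun c h1 h2 => ?_⟩
    obtain ⟨z, rfl⟩ := e.surj ((e.lo x).trans h1.le) (h2.le.trans (e.hi y))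
    exact h.2 (e.lt.1 h1) (e.lt.1 h2)

theorem Emb.sup {f : γ → α} {u v : α} (e : Emb f u v) (x y : γ) : f (x ⊔ y) = f x ⊔ f y := by
  apply le_antisymm
  · obtain ⟨z, hz⟩ := e.surj ((e.lo x).trans le_sup_left) (sup_le (e.hi x) (e.hi y))
    rw [← hz, e.le]
    exact sup_le (e.le.1 (hz ▸ le_sup_left)) (e.le.1 (hz ▸ le_sup_right))
  · exact sup_le (e.le.2 le_sup_left) (e.le.2 le_sup_right)

theorem Emb.inf {f : γ → α} {u v : α} (e : Emb f u v) (x y : γ) : f (x ⊓ y) = f x ⊓ f y := by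
  apply le_antisymm
  · exact le_inf (e.le.2 inf_le_left) (e.le.2 inf_le_right)
  · obtain ⟨z, hz⟩ := e.surj (le_inf (e.lo x) (e.lo y)) (inf_le_left.trans (e.hi x))
    rw [← hz, e.le]
    exact le_inf (e.le.1 (hz ▸ inf_le_left)) (e.le.1 (hz ▸ inf_le_right))

theorem Good.isMatch {P : α → α → Prop} (hP : IsMatch P) {f : γ → α} {u v : α} (huv : u ≤ v)
    (e : Emb f u v) (g : Good P f u v) : IsMatch (IndQ P f u v) := by
  refine ⟨?_, ?_, ?_, ?_, ?_, ?_, ?_, ?_, ?_⟩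
  · rintro x y ⟨j, m, h, h1, h2, h3, h4⟩; exact (g.J1 h h1 h2 h3).1
  · rintro x y ⟨j, m, h, h1, h2, h3, h4⟩; exact (g.M1 h h1 h2 h4).1
  · rintro x y ⟨j, m, h, h1, h2, h3, h4⟩ hle
    apply hP.nle h
    have := e.le.2 hle
    rw [h3, h4] at this
    exact le_sup_right.trans (this.trans inf_le_right)
  · rintro x y z ⟨j, m, h, h1, h2, h3, h4⟩ hz
    rw [← e.le, h4]
    exact le_inf (e.hi _) ((g.J1 h h1 h2 h3).2 z hz)
  · rintro x y z ⟨j, m, h, h1, h2, h3, h4⟩ hz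
    rw [← e.le, h3]
    exact sup_le (e.lo _) ((g.M1 h h1 h2 h4).2 z hz)
  · intro x hx
    obtain ⟨j, m, h, h1, h2, h3⟩ := g.J2 hx
    obtain ⟨y, hy⟩ := e.surj (le_inf huv h2) inf_le_left
    exact ⟨y, j, m, h, h1, h2, h3, hy⟩
  · intro x hx
    obtain ⟨j, m, h, h1, h2, h3⟩ := g.M2 hx
    obtain ⟨y, hy⟩ := e.surj le_sup_left (sup_le huv h1)
    exact ⟨y, j, m, h, h1, h2, hy, h3⟩
  · rintro x y y' ⟨j, m, h, h1, h2, h3, h4⟩ ⟨j', m', h', h1', h2', h3', h4'⟩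
    obtain rfl := g.J3 h h' h1 h2 h1' h2' (h3.symm.trans h3')
    obtain rfl := hP.um h h'
    exact e.inj (h4.trans h4'.symm)
  · rintro x x' y ⟨j, m, h, h1, h2, h3, h4⟩ ⟨j', m', h', h1', h2', h3', h4'⟩
    obtain rfl := g.M3 h h' h1 h2 h1' h2' (h4.symm.trans h4')
    obtain rfl := hP.uj h h'
    exact e.inj (h3.trans h3'.symm)

theorem Good.dInd {P : α → α → Prop} (hD : DInd P) {f : γ → α} {u v : α}
    (e : Emb f u v) : DInd (IndQ P f u v) := by
  rintro x y y' a b a' b' ⟨j, m, h, h1, h2, h3, h4⟩ ⟨j', m', h', h1', h2', h3', h4'⟩ c c' l l' k k' ne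
  rw [← e.le] at l l' k k' ⊢
  rw [h3] at l ⊢; rw [h3'] at l'; rw [h4] at k; rw [h4'] at k' ⊢
  have := hD h h' (e.cov.2 c) (e.cov.2 c') (le_sup_right.trans l) (le_sup_right.trans l')
    (k.trans inf_le_right) (k'.trans inf_le_right) (by
      rintro rfl; exact ne (e.inj (h3.trans h3'.symm)))
  exact le_inf (l.trans (e.hi _)) (sup_le h2' this)

theorem Good.uInd {P : α → α → Prop} (hD : UInd P) {f : γ → α} {u v : α}
    (e : Emb f u v) : UInd (IndQ P f u v) := by
  rintro x y y' a b a' b' ⟨j, m, h, h1, h2, h3, h4⟩ ⟨j', m', h', h1', h2', h3', h4'⟩ c c' l l' k k' ne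
  rw [← e.le] at l l' k k' ⊢
  rw [h3] at l ⊢; rw [h3'] at l'; rw [h4] at k; rw [h4'] at k' ⊢
  have := hD h h' (e.cov.2 c) (e.cov.2 c') (le_sup_right.trans l) (le_sup_right.trans l')
    (k.trans inf_le_right) (k'.trans inf_le_right) (by
      rintro rfl; exact ne (e.inj (h3.trans h3'.symm)))
  exact le_inf (l.trans (e.hi _)) (sup_le h2' this)

theorem Good.comp {P : α → α → Prop} {g : β → α} {u1 v1 : α} (huv1 : u1 ≤ v1)
    (e : Emb g u1 v1) {f : γ → β} {u v : β}
    (G : Good P g u1 v1) (F : Good (IndQ P g u1 v1) f u v) : Good P (g ∘ f) (g u) (g v) := by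
  have key : ∀ {j m}, P j m → j ≤ g v → g u ≤ m → ∃ a b, IndQ P g u1 v1 a b ∧ g a = u1 ⊔ j ∧
      g b = v1 ⊓ m ∧ a ≤ v ∧ u ≤ b := by
    intro j m h h1 h2
    have h1' := h1.trans (e.hi v)
    have h2' := (e.lo u).trans h2
    obtain ⟨a, ha⟩ := e.surj le_sup_left (sup_le huv1 h1')
    obtain ⟨b, hb⟩ := e.surj (le_inf huv1 h2') inf_le_left
    refine ⟨a, b, ⟨j, m, h, h1', h2', ha, hb⟩, ha, hb, ?_, ?_⟩
    · rw [← e.le, ha]; exact sup_le (e.lo _) h1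
    · rw [← e.le, hb]; exact le_inf (e.hi _) h2
  have s1 : ∀ {a j}, g a = u1 ⊔ j → g (u ⊔ a) = g u ⊔ j := by
    intro a j h
    rw [e.sup, h, ← sup_assoc, sup_eq_left.2 (e.lo u)]
  have s2 : ∀ {a j}, g a = v1 ⊓ j → g (v ⊓ a) = g v ⊓ j := by
    intro a j h
    rw [e.inf, h, ← inf_assoc, inf_eq_left.2 (e.hi v)]
  refine ⟨?_, ?_, ?_, ?_, ?_, ?_⟩
  · intro j m x h h1 h2 h3
    obtain ⟨a, b, q, ha, hb, hav, hub⟩ := key h h1 h2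
    obtain ⟨r1, r2⟩ := F.J1 q hav hub (e.inj (h3.trans (s1 ha).symm))
    refine ⟨r1, fun y hy => ?_⟩
    have := e.le.2 (r2 y hy)
    rw [hb] at this
    exact this.trans inf_le_right
  · intro x hx
    obtain ⟨a, b, ⟨j, m, h, h1, h2, ha, hb⟩, hav, hub, hx⟩ := F.J2 hx
    refine ⟨j, m, h, ?_, ?_, ?_⟩
    · exact le_sup_right.trans (ha ▸ e.le.2 hav)
    · exact (e.le.2 hub).trans (hb ▸ inf_le_right)
    · show g (f x) = _
      rw [hx, s1 ha]
  · intro j m j' m' h h' h1 h2 h1' h2' eq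
    obtain ⟨a, b, q, ha, hb, hav, hub⟩ := key h h1 h2
    obtain ⟨a', b', q', ha', hb', hav', hub'⟩ := key h' h1' h2'
    rw [← s1 ha, ← s1 ha'] at eq
    have := F.J3 q q' hav hub hav' hub' (e.inj eq)
    subst this
    exact G.J3 h h' (h1.trans (e.hi v)) ((e.lo u).trans h2) (h1'.trans (e.hi v))
      ((e.lo u).trans h2') (ha.symm.trans ha')
  · intro j m x h h1 h2 h3
    obtain ⟨a, b, q, ha, hb, hav, hub⟩ := key h h1 h2
    obtain ⟨r1, r2⟩ := F.M1 q hav hub (e.inj (h3.trans (s2 hb).symm))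
    refine ⟨r1, fun y hy => ?_⟩
    have := e.le.2 (r2 y hy)
    rw [ha] at this
    exact le_sup_right.trans this
  · intro x hx
    obtain ⟨a, b, ⟨j, m, h, h1, h2, ha, hb⟩, hav, hub, hx⟩ := F.M2 hx
    refine ⟨j, m, h, ?_, ?_, ?_⟩
    · exact le_sup_right.trans (ha ▸ e.le.2 hav)
    · exact (e.le.2 hub).trans (hb ▸ inf_le_right)
    · show g (f x) = _
      rw [hx, s2 hb]
  · intro j m j' m' h h' h1 h2 h1' h2' eq
    obtain ⟨a, b, q, ha, hb, hav, hub⟩ := key h h1 h2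
    obtain ⟨a', b', q', ha', hb', hav', hub'⟩ := key h' h1' h2'
    rw [← s2 hb, ← s2 hb'] at eq
    have := F.M3 q q' hav hub hav' hub' (e.inj eq)
    subst this
    exact G.M3 h h' (h1.trans (e.hi v)) ((e.lo u).trans h2) (h1'.trans (e.hi v))
      ((e.lo u).trans h2') (hb.symm.trans hb')

theorem Good.uniq [Finite γ] {P : α → α → Prop} (hP : IsMatch P)
    (hu : ∀ P', IsMatch P' → ∀ j m, P' j m → P j m)
    {f : γ → α} {u v : α} (huv : u ≤ v)
    (e : Emb f u v) (g : Good P f u v) (Q : γ → γ → Prop) (hQ : IsMatch Q) :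
    ∀ x y, Q x y → IndQ P f u v x y := by
  let P' : α → α → Prop := fun j m => (P j m ∧ ¬ (j ≤ v ∧ u ≤ m)) ∨
    ∃ j1 m1 x y, P j m1 ∧ j ≤ v ∧ u ≤ m1 ∧ P j1 m ∧ j1 ≤ v ∧ u ≤ m ∧ f x = u ⊔ j ∧ f y = v ⊓ m ∧
      Q x y
  have hP' : IsMatch P' := by
    refine ⟨?_, ?_, ?_, ?_, ?_, ?_, ?_, ?_, ?_⟩
    · rintro j m (⟨h, -⟩ | ⟨j1, m1, x, y, h, -⟩)
      · exact hP.ji h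
      · exact hP.ji h
    · rintro j m (⟨h, -⟩ | ⟨j1, m1, x, y, -, -, -, h, -⟩)
      · exact hP.mi h
      · exact hP.mi h
    · rintro j m (⟨h, -⟩ | ⟨j1, m1, x, y, h1, h2, h3, h4, h5, h6, h7, h8, q⟩) hle
      · exact hP.nle h hle
      · apply hQ.nle q
        rw [← e.le, h7, h8]
        exact le_inf (sup_le huv h2) (sup_le h6 hle)
    · rintro j m z (⟨h, -⟩ | ⟨j1, m1, x, y, h1, h2, h3, h4, h5, h6, h7, h8, q⟩) hz
      · exact hP.lo h hz
      · obtain ⟨t, ht⟩ := e.surj (a := (u ⊔ j) ⊓ m1) (le_inf le_sup_left h3)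
          (inf_le_left.trans (sup_le huv h2))
        have htx : t < x := by
          rw [← e.lt, h7, ht]
          refine lt_of_le_of_ne inf_le_left (fun h => ?_)
          exact hP.nle h1 (le_sup_right.trans (inf_eq_left.1 h))
        obtain ⟨s, hs, hs2⟩ := exCovL htx
        have h9 := e.le.2 (hQ.lo q hs2)
        rw [h8] at h9
        calc z ≤ (u ⊔ j) ⊓ m1 := le_inf (hz.le.trans le_sup_right) (hP.lo h1 hz)
          _ = f t := ht.symm
          _ ≤ f s := e.le.2 hs
          _ ≤ v ⊓ m := h9
          _ ≤ m := inf_le_right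
    · rintro j m z (⟨h, -⟩ | ⟨j1, m1, x, y, h1, h2, h3, h4, h5, h6, h7, h8, q⟩) hz
      · exact hP.hi h hz
      · obtain ⟨t, ht⟩ := e.surj (a := (v ⊓ m) ⊔ j1) ((le_inf huv h6).trans le_sup_left)
          (sup_le inf_le_left h5)
        have htx : y < t := by
          rw [← e.lt, h8, ht]
          refine lt_of_le_of_ne le_sup_left (fun h => ?_)
          exact hP.nle h4 ((sup_eq_left.1 h.symm).trans inf_le_right)
        obtain ⟨s, hs, hs2⟩ := exCovU htx
        have h9 := e.le.2 (hQ.hi q hs)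
        rw [h7] at h9
        calc j ≤ u ⊔ j := le_sup_right
          _ ≤ f s := h9
          _ ≤ f t := e.le.2 hs2
          _ = (v ⊓ m) ⊔ j1 := ht
          _ ≤ z := sup_le (inf_le_right.trans hz.le) (hP.hi h4 hz)
    · intro j hj
      obtain ⟨m1, h1⟩ := hP.exm hj
      by_cases hS : j ≤ v ∧ u ≤ m1
      · obtain ⟨x, hx⟩ := e.surj le_sup_left (sup_le huv hS.1)
        obtain ⟨y, hy⟩ := hQ.exm (g.J1 h1 hS.1 hS.2 hx).1
        obtain ⟨j1, m, h2, h3, h4, h5⟩ := g.M2 (hQ.mi hy)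
        exact ⟨m, Or.inr ⟨j1, m1, x, y, h1, hS.1, hS.2, h2, h3, h4, hx, h5, hy⟩⟩
      · exact ⟨m1, Or.inl ⟨h1, hS⟩⟩
    · intro m hm
      obtain ⟨j1, h1⟩ := hP.exj hm
      by_cases hS : j1 ≤ v ∧ u ≤ m
      · obtain ⟨y, hy⟩ := e.surj (le_inf huv hS.2) inf_le_left
        obtain ⟨x, hx⟩ := hQ.exj (g.M1 h1 hS.1 hS.2 hy).1
        obtain ⟨j, m1, h2, h3, h4, h5⟩ := g.J2 (hQ.ji hx)
        exact ⟨j, Or.inr ⟨j1, m1, x, y, h2, h3, h4, h1, hS.1, hS.2, h5, hy, hx⟩⟩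
      · exact ⟨j1, Or.inl ⟨h1, hS⟩⟩
    · rintro j m m' (⟨h, hn⟩ | ⟨j1, m1, x, y, h1, h2, h3, h4, h5, h6, h7, h8, q⟩)
        (⟨h', hn'⟩ | ⟨j1', m1', x', y', h1', h2', h3', h4', h5', h6', h7', h8', q'⟩)
      · exact hP.um h h'
      · obtain rfl := hP.um h h1'
        exact absurd ⟨h2', h3'⟩ hn
      · obtain rfl := hP.um h' h1
        exact absurd ⟨h2, h3⟩ hn'
      · obtain rfl := e.inj (h7.trans h7'.symm)
        obtain rfl := hQ.um q q'
        exact g.M3 h4 h4' h5 h6 h5' h6' (h8.symm.trans h8')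
    · rintro j j' m (⟨h, hn⟩ | ⟨j1, m1, x, y, h1, h2, h3, h4, h5, h6, h7, h8, q⟩)
        (⟨h', hn'⟩ | ⟨j1', m1', x', y', h1', h2', h3', h4', h5', h6', h7', h8', q'⟩)
      · exact hP.uj h h'
      · obtain rfl := hP.uj h h4'
        exact absurd ⟨h5', h6'⟩ hn
      · obtain rfl := hP.uj h' h4
        exact absurd ⟨h5, h6⟩ hn'
      · obtain rfl := e.inj (h8.trans h8'.symm)
        obtain rfl := hQ.uj q q'
        exact g.J3 h1 h1' h2 h3 h2' h3' (h7.symm.trans h7')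
  intro x y q
  obtain ⟨j, m1, h1, h2, h3, h7⟩ := g.J2 (hQ.ji q)
  obtain ⟨j1, m, h4, h5, h6, h8⟩ := g.M2 (hQ.mi q)
  exact ⟨j, m, hu P' hP' j m (Or.inr ⟨j1, m1, x, y, h1, h2, h3, h4, h5, h6, h7, h8, q⟩),
    h2, h6, h7, h8⟩

theorem cd_step [Finite β] {P : β → β → Prop} (hP : IsMatch P)
    (hu : ∀ P', IsMatch P' → ∀ j m, P' j m → P j m)
    (j0 m0 : β) (hpp : IsPrimePair j0 m0)
    (hup : CompatiblyDismantlable ↥(Set.Ici j0)) (hdn : CompatiblyDismantlable ↥(Set.Iic m0))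
    {Pu : Set.Ici j0 → Set.Ici j0 → Prop} (hPu : IsMatch Pu)
    (huu : ∀ P', IsMatch P' → ∀ j m, P' j m → Pu j m)
    {Pd : Set.Iic m0 → Set.Iic m0 → Prop} (hPd : IsMatch Pd)
    (hud : ∀ P', IsMatch P' → ∀ j m, P' j m → Pd j m)
    (ha : ∀ j m, P j m → ∀ h : j0 ≤ m, Pu ⟨j0 ⊔ j, Set.mem_Ici.mpr le_sup_left⟩ ⟨m, h⟩)
    (hai : ∀ j m j' m', P j m → P j' m' → j0 ≤ m → j0 ≤ m' → j0 ⊔ j = j0 ⊔ j' → j = j')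
    (has : ∀ x : Set.Ici j0, JoinIrred x → ∃ j m, P j m ∧ j0 ≤ m ∧ j0 ⊔ j = x.1)
    (hb : ∀ j m, P j m → ∀ h : j ≤ m0, Pd ⟨j, h⟩ ⟨m0 ⊓ m, Set.mem_Iic.mpr inf_le_left⟩)
    (hbi : ∀ j m j' m', P j m → P j' m' → j ≤ m0 → j' ≤ m0 → m0 ⊓ m = m0 ⊓ m' → j = j')
    (hbs : ∀ x : Set.Iic m0, MeetIrred x → ∃ j m, P j m ∧ j ≤ m0 ∧ m0 ⊓ m = x.1) :
    CompatiblyDismantlable β := by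
  have un : ∀ {δ : Type u} [Lattice δ] [Finite δ] {R : δ → δ → Prop} (hR : IsMatch R)
      (hu : ∀ P', IsMatch P' → ∀ j m, P' j m → R j m)
      (κ : {j : δ // JoinIrred j} → {m : δ // MeetIrred m}) (_ : ∀ j, R j.1 (κ j).1),
      ∀ κ', IsPairing κ' → κ' = κ := by
    intro δ _ _ R hR hu κ hk κ' hκ'
    funext j
    apply Subtype.ext
    exact hR.um (hu _ (toMatch hκ') _ _ ⟨j.2, rfl⟩) (hk j)
  obtain ⟨κ, k1, k2⟩ := ofMatch hP
  obtain ⟨κu, ku1, ku2⟩ := ofMatch hPu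
  obtain ⟨κd, kd1, kd2⟩ := ofMatch hPd
  refine CompatiblyDismantlable.step β κ k1 (un hP hu κ k2) j0 m0 hpp hup hdn κu ku1
    (un hPu huu κu ku2) κd kd1 (un hPd hud κd kd2) ?_ ?_ ?_ ?_ ?_ ?_
  · intro j h
    have := ha _ _ (k2 j) h
    refine ⟨hPu.ji this, ?_⟩
    exact congrArg Subtype.val (hPu.um (ku2 ⟨_, hPu.ji this⟩) this)
  · intro j j' h h' eq
    exact Subtype.ext (hai _ _ _ _ (k2 j) (k2 j') h h' eq)
  · intro x
    obtain ⟨j, m, h, h1, h2⟩ := has x.1 x.2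
    refine ⟨⟨j, hP.ji h⟩, ?_, h2⟩
    rwa [hP.um (k2 ⟨j, hP.ji h⟩) h]
  · intro j h
    have := hb _ _ (k2 j) h
    refine ⟨hPd.ji this, ?_⟩
    exact congrArg Subtype.val (hPd.um (kd2 ⟨_, hPd.ji this⟩) this)
  · intro j j' h h' eq
    exact Subtype.ext (hbi _ _ _ _ (k2 j) (k2 j') h h' eq)
  · intro x
    obtain ⟨j, m, h, h1, h2⟩ := hbs x.1 x.2
    refine ⟨⟨j, hP.ji h⟩, h1, ?_⟩
    rwa [hP.um (k2 ⟨j, hP.ji h⟩) h]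

theorem embUp {f : γ → α} {u v j0 : α} (e : Emb f u v) {j0' : γ} (h : f j0' = u ⊔ j0) :
    Emb (fun x : Set.Ici j0' => f x.1) (u ⊔ j0) v := by
  refine ⟨?_, ?_, ?_, ?_⟩
  · intro x y; exact e.le
  · intro x; rw [← h]; exact e.le.2 x.2
  · intro x; exact e.hi _
  · intro a h1 h2
    obtain ⟨x, rfl⟩ := e.surj (le_sup_left.trans h1) h2
    exact ⟨⟨x, e.le.1 (h ▸ h1)⟩, rfl⟩

theorem embDn {f : γ → α} {u v m0 : α} (e : Emb f u v) {m0' : γ} (h : f m0' = v ⊓ m0) :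
    Emb (fun x : Set.Iic m0' => f x.1) u (v ⊓ m0) := by
  refine ⟨?_, ?_, ?_, ?_⟩
  · intro x y; exact e.le
  · intro x; exact e.lo _
  · intro x; rw [← h]; exact e.le.2 x.2
  · intro a h1 h2
    obtain ⟨x, rfl⟩ := e.surj h1 (h2.trans inf_le_left)
    exact ⟨⟨x, e.le.1 (h ▸ h2)⟩, rfl⟩

theorem straddle [Finite α] [Finite γ] {P : α → α → Prop} (hP : IsMatch P) (hD : DInd P)
    (hU : UInd P) {j0 m0 : α} (hpp : IsPrimePair j0 m0) (h0 : P j0 m0)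
    {f : γ → α} {u v : α} (huv : u ≤ v) (e : Emb f u v) (hu0 : u ≤ m0) (hv0 : j0 ≤ v)
    {j0' m0' : γ} (hj0 : f j0' = u ⊔ j0) (hm0 : f m0' = v ⊓ m0)
    (Gu : Good P (fun x : Set.Ici j0' => f x.1) (u ⊔ j0) v)
    (Gd : Good P (fun x : Set.Iic m0' => f x.1) u (v ⊓ m0)) : Good P f u v := by
  have eu := embUp e hj0
  have ed := embDn e hm0
  have hle : ∀ {a}, ¬ j0 ≤ a → a ≤ m0 := fun {a} h => (hpp a).1.resolve_right h
  have hge : ∀ {a}, ¬ a ≤ m0 → j0 ≤ a := fun {a} h => (hpp a).1.resolve_left h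
  have hno : ∀ {a}, a ≤ m0 → j0 ≤ a → False := fun {a} h h' => (hpp a).2 ⟨h, h'⟩
  have mu : ∀ {x}, j0' ≤ x ↔ j0 ≤ f x := by
    intro x
    rw [← e.le, hj0]
    exact ⟨fun h => le_sup_right.trans h, fun h => sup_le (e.lo _) h⟩
  have md : ∀ {x}, x ≤ m0' ↔ f x ≤ m0 := by
    intro x
    rw [← e.le, hm0]
    exact ⟨fun h => h.trans inf_le_right, fun h => le_inf (e.hi _) h⟩
  have cu : ∀ {x y : Set.Ici j0'}, x ⋖ y ↔ x.1 ⋖ y.1 := by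
    intro x y; rw [← eu.cov, ← e.cov]
  have cd : ∀ {x y : Set.Iic m0'}, x ⋖ y ↔ x.1 ⋖ y.1 := by
    intro x y; rw [← ed.cov, ← e.cov]
  have tj : ∀ {j m}, P j m → j ≠ j0 → j0 ≤ j → j0 ≤ m := by
    intro j m h hne hl
    obtain ⟨y, h1, h2⟩ := exCovL (lt_of_le_of_ne hl hne.symm)
    exact h1.trans (hP.lo h h2)
  have tm : ∀ {j m}, P j m → m ≠ m0 → m ≤ m0 → j ≤ m0 := by
    intro j m h hne hl
    obtain ⟨y, h1, h2⟩ := exCovU (lt_of_le_of_ne hl hne)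
    exact (hP.hi h h1).trans h2
  refine ⟨?_, ?_, ?_, ?_, ?_, ?_⟩
  · intro j m x h h1 h2 h3
    by_cases hj : j0 ≤ j
    · by_cases hjj : j = j0
      · subst hjj
        obtain rfl := hP.um h0 h
        have A : ∀ y, y < x → f y ≤ m0 := by
          intro y hy
          refine hle fun hc => ?_
          have := e.lt.2 hy
          rw [h3] at this
          exact not_le_of_gt this (sup_le (e.lo _) hc)
        obtain ⟨t, ht⟩ := e.surj (a := (u ⊔ j) ⊓ m0) (le_inf le_sup_left hu0)
          (inf_le_left.trans (sup_le huv hv0))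
        refine ⟨ji_of (t := t) ?_ ?_, fun y hy => A y hy.lt⟩
        · rw [← e.lt, ht, h3]
          refine lt_of_le_of_ne inf_le_left fun hc => ?_
          exact hno (inf_eq_left.1 hc) le_sup_right
        · intro y hy
          rw [← e.le, ht]
          exact le_inf (h3 ▸ (e.le.2 hy.le)) (A y hy)
      · have hm := tj h hjj hj
        have hx : j0' ≤ x := mu.2 (h3 ▸ hj.trans le_sup_right)
        obtain ⟨⟨t, ht, htu⟩, r2⟩ := Gu.J1 (x := ⟨x, hx⟩) h h1 (sup_le h2 hm) (by
          show f x = _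
          rw [h3, sup_assoc, sup_eq_right.2 hj])
        have htx := cu.1 ht
        have A : ∀ y, y ⋖ x → j0' ≤ y := by
          intro y hy
          by_contra hc
          have hy0 : f y ≤ m0 := hle fun hc' => hc (mu.2 hc')
          have := hD h h0 (e.cov.2 htx) (e.cov.2 hy) (by rw [h3]; exact le_sup_right)
            (mu.1 hx) (r2 _ ht) hy0 hjj
          exact hno this hj
        refine ⟨⟨t.1, htx, fun y hy => ?_⟩, fun y hy => ?_⟩
        · have := htu ⟨y, A y hy⟩ (cu.2 hy)
          rw [← this]
        · exact r2 ⟨y, A y hy⟩ (cu.2 hy)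
    · have hj' := hle hj
      have hx : x ≤ m0' := md.2 (h3 ▸ sup_le hu0 hj')
      obtain ⟨⟨t, ht, htu⟩, r2⟩ := Gd.J1 (x := ⟨x, hx⟩) h (le_inf h1 hj') h2 h3
      refine ⟨⟨t.1, cd.1 ht, fun y hy => ?_⟩, fun y hy => ?_⟩
      · have := htu ⟨y, hy.le.trans hx⟩ (cd.2 hy)
        rw [← this]
      · exact r2 ⟨y, hy.le.trans hx⟩ (cd.2 hy)
  · intro x hx
    by_cases hx0 : j0 ≤ f x
    · have hxu := mu.2 hx0
      by_cases hxe : x = j0'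
      · subst hxe
        exact ⟨j0, m0, h0, hv0, hu0, hj0⟩
      · obtain ⟨y, hy1, hy2⟩ := exCovL (lt_of_le_of_ne hxu (Ne.symm hxe))
        have hx' : JoinIrred (⟨x, hxu⟩ : Set.Ici j0') := by
          refine ⟨⟨y, hy1⟩, cu.2 hy2, fun z hz => Subtype.ext ?_⟩
          exact hx.unique (cu.1 hz) hy2
        obtain ⟨j, m, h, h1, h2, h3⟩ := Gu.J2 hx'
        simp only at h3
        by_cases hj : j0 ≤ j
        · refine ⟨j, m, h, h1, le_sup_left.trans h2, ?_⟩
          rw [h3, sup_assoc, sup_eq_right.2 hj]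
        · exfalso
          obtain ⟨a, ha⟩ := e.surj le_sup_left (sup_le huv h1)
          have hax : a < x := by
            rw [← e.lt, ha, h3]
            refine lt_of_le_of_ne (sup_le_sup_right le_sup_left _) fun hc => ?_
            apply hno (sup_le hu0 (hle hj))
            rw [hc]
            exact le_sup_right.trans le_sup_left
          have := ji_sup hx (lt_of_le_of_ne hxu (Ne.symm hxe)) hax
          rw [← e.lt, e.sup, hj0, ha, h3] at this
          refine not_le_of_gt this (sup_le le_sup_left (le_sup_right.trans le_sup_right))
    · have hxd := md.2 (hle hx0)
      have hx' : JoinIrred (⟨x, hxd⟩ : Set.Iic m0') := by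
        obtain ⟨y, hy, hyu⟩ := hx
        refine ⟨⟨y, hy.le.trans hxd⟩, cd.2 hy, fun z hz => Subtype.ext ?_⟩
        exact hyu _ (cd.1 hz)
      obtain ⟨j, m, h, h1, h2, h3⟩ := Gd.J2 hx'
      exact ⟨j, m, h, h1.trans inf_le_left, h2, h3⟩
  · have key : ∀ {j' m'}, P j' m' → u ≤ m' → j0 ≤ j' → j' ≠ j0 → u ⊔ j0 = u ⊔ j' → False := by
      intro j' m' h h2 h3 h4 h5
      apply hP.nle h
      exact (le_sup_right.trans h5.ge).trans (sup_le h2 (tj h h4 h3))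
    intro j m j' m' h h' h1 h2 h1' h2' eq
    by_cases hj : j0 ≤ j <;> by_cases hj' : j0 ≤ j'
    · by_cases a : j = j0 <;> by_cases b : j' = j0
      · rw [a, b]
      · subst a; exact (key h' h2' hj' b eq).elim
      · subst b; exact (key h h2 hj a eq.symm).elim
      · apply Gu.J3 h h' h1 (sup_le h2 (tj h a hj)) h1' (sup_le h2' (tj h' b hj'))
        rw [sup_assoc, sup_assoc, sup_eq_right.2 hj, sup_eq_right.2 hj', eq]
    · exact (hno (sup_le hu0 (hle hj')) ((hj.trans le_sup_right).trans eq.le)).elim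
    · exact (hno (sup_le hu0 (hle hj)) ((hj'.trans le_sup_right).trans eq.ge)).elim
    · exact Gd.J3 h h' (le_inf h1 (hle hj)) h2 (le_inf h1' (hle hj')) h2' eq
  · intro j m x h h1 h2 h3
    by_cases hj : m ≤ m0
    · by_cases hjj : m = m0
      · subst hjj
        obtain rfl := hP.uj h0 h
        have A : ∀ y, x < y → j0 ≤ f y := by
          intro y hy
          refine hge fun hc => ?_
          have := e.lt.2 hy
          rw [h3] at this
          exact not_le_of_gt this (le_inf (e.hi _) hc)
        obtain ⟨t, ht⟩ := e.surj (a := (v ⊓ m) ⊔ j0) ((le_inf huv hu0).trans le_sup_left)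
          (sup_le inf_le_left hv0)
        refine ⟨mi_of (t := t) ?_ ?_, fun y hy => A y hy.lt⟩
        · rw [← e.lt, ht, h3]
          refine lt_of_le_of_ne le_sup_left fun hc => ?_
          exact hno inf_le_right (sup_eq_left.1 hc.symm)
        · intro y hy
          rw [← e.le, ht]
          exact sup_le (h3 ▸ (e.le.2 hy.le)) (A y hy)
      · have hm := tm h hjj hj
        have hx : x ≤ m0' := md.2 (h3 ▸ inf_le_right.trans hj)
        obtain ⟨⟨t, ht, htu⟩, r2⟩ := Gd.M1 (x := ⟨x, hx⟩) h (le_inf h1 hm) h2 (by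
          show f x = _
          rw [h3, inf_assoc, inf_eq_right.2 hj])
        have htx := cd.1 ht
        have A : ∀ y, x ⋖ y → y ≤ m0' := by
          intro y hy
          by_contra hc
          have hy0 : j0 ≤ f y := hge fun hc' => hc (md.2 hc')
          have hne : j0 ≠ j := by
            rintro rfl; exact hjj (hP.um h h0)
          have := hU h0 h (e.cov.2 hy) (e.cov.2 htx) hy0 (r2 _ ht) (md.1 hx)
            (by rw [h3]; exact inf_le_right) hne
          exact hno hj this
        refine ⟨⟨t.1, htx, fun y hy => ?_⟩, fun y hy => ?_⟩
        · have := htu ⟨y, A y hy⟩ (cd.2 hy)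
          rw [← this]
        · exact r2 ⟨y, A y hy⟩ (cd.2 hy)
    · have hj' := hge hj
      have hx : j0' ≤ x := mu.2 (h3 ▸ le_inf hv0 hj')
      obtain ⟨⟨t, ht, htu⟩, r2⟩ := Gu.M1 (x := ⟨x, hx⟩) h h1 (sup_le h2 hj') h3
      refine ⟨⟨t.1, cu.1 ht, fun y hy => ?_⟩, fun y hy => ?_⟩
      · have := htu ⟨y, hx.trans hy.le⟩ (cu.2 hy)
        rw [← this]
      · exact r2 ⟨y, hx.trans hy.le⟩ (cu.2 hy)
  · intro x hx
    by_cases hx0 : f x ≤ m0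
    · have hxu := md.2 hx0
      by_cases hxe : x = m0'
      · subst hxe
        exact ⟨j0, m0, h0, hv0, hu0, hm0⟩
      · obtain ⟨y, hy1, hy2⟩ := exCovU (lt_of_le_of_ne hxu hxe)
        have hx' : MeetIrred (⟨x, hxu⟩ : Set.Iic m0') := by
          refine ⟨⟨y, hy2⟩, cd.2 hy1, fun z hz => Subtype.ext ?_⟩
          exact hx.unique (cd.1 hz) hy1
        obtain ⟨j, m, h, h1, h2, h3⟩ := Gd.M2 hx'
        simp only at h3
        by_cases hj : m ≤ m0
        · refine ⟨j, m, h, h1.trans inf_le_left, h2, ?_⟩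
          rw [h3, inf_assoc, inf_eq_right.2 hj]
        · exfalso
          obtain ⟨a, ha⟩ := e.surj (le_inf huv h2) inf_le_left
          have hax : x < a := by
            rw [← e.lt, ha, h3]
            refine lt_of_le_of_ne (inf_le_inf_right _ inf_le_left) fun hc => ?_
            refine hno ?_ (le_inf hv0 (hge hj))
            rw [← hc]
            exact inf_le_left.trans inf_le_right
          have := mi_inf hx (lt_of_le_of_ne hxu hxe) hax
          rw [← e.lt, e.inf, hm0, ha, h3] at this
          refine not_le_of_gt this (le_inf inf_le_left (inf_le_right.trans inf_le_right))
    · have hxd := mu.2 (hge hx0)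
      have hx' : MeetIrred (⟨x, hxd⟩ : Set.Ici j0') := by
        obtain ⟨y, hy, hyu⟩ := hx
        refine ⟨⟨y, le_trans hxd hy.le⟩, cu.2 hy, fun z hz => Subtype.ext ?_⟩
        exact hyu _ (cu.1 hz)
      obtain ⟨j, m, h, h1, h2, h3⟩ := Gu.M2 hx'
      exact ⟨j, m, h, h1, le_sup_left.trans h2, h3⟩
  · have key : ∀ {j' m'}, P j' m' → j' ≤ v → m' ≤ m0 → m' ≠ m0 → v ⊓ m0 = v ⊓ m' → False := by
      intro j' m' h h2 h3 h4 h5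
      apply hP.nle h
      exact (le_inf h2 (tm h h4 h3)).trans (h5.le.trans inf_le_right)
    intro j m j' m' h h' h1 h2 h1' h2' eq
    by_cases hj : m ≤ m0 <;> by_cases hj' : m' ≤ m0
    · by_cases a : m = m0 <;> by_cases b : m' = m0
      · rw [a, b]
      · subst a; exact (key h' h1' hj' b eq).elim
      · subst b; exact (key h h1 hj a eq.symm).elim
      · apply Gd.M3 h h' (le_inf h1 (tm h a hj)) h2 (le_inf h1' (tm h' b hj')) h2'
        rw [inf_assoc, inf_assoc, inf_eq_right.2 hj, inf_eq_right.2 hj', eq]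
    · exact (hno (eq.ge.trans (inf_le_right.trans hj)) (le_inf hv0 (hge hj'))).elim
    · exact (hno (eq.le.trans (inf_le_right.trans hj')) (le_inf hv0 (hge hj))).elim
    · exact Gu.M3 h h' h1 (sup_le h2 (hge hj)) h1' (sup_le h2' (hge hj')) eq

theorem prime_rel [Finite α] {P : α → α → Prop} (hP : IsMatch P) {j0 m0 : α}
    (hpp : IsPrimePair j0 m0) : P j0 m0 := by
  have hle : ∀ {a}, ¬ j0 ≤ a → a ≤ m0 := fun {a} h => (hpp a).1.resolve_right h
  have hno : ∀ {a}, a ≤ m0 → j0 ≤ a → False := fun {a} h h' => (hpp a).2 ⟨h, h'⟩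
  have hj : JoinIrred j0 := by
    refine ji_of (t := j0 ⊓ m0) (lt_of_le_of_ne inf_le_left fun h => hno (inf_eq_left.1 h) le_rfl) ?_
    intro y hy
    exact le_inf hy.le (hle (not_le_of_gt hy))
  obtain ⟨m, hm⟩ := hP.exm hj
  have h1 : m ≤ m0 := hle (hP.nle hm)
  rcases h1.lt_or_eq with h | h
  · obtain ⟨y, hy, hy2⟩ := exCovU h
    exact (hno hy2 (hP.hi hm hy)).elim
  · rwa [← h]

theorem ex_top [Finite α] (a : α) : ∃ t : α, ∀ x, x ≤ t := by
  obtain ⟨t, -, ht⟩ := Set.Finite.exists_le_maximal (Set.toFinite (Set.univ : Set α)) (Set.mem_univ a)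
  exact ⟨t, fun x => le_sup_right.trans (ht.2 (Set.mem_univ (t ⊔ x)) le_sup_left)⟩

theorem ex_bot [Finite α] (a : α) : ∃ t : α, ∀ x, t ≤ x := by
  obtain ⟨t, -, ht⟩ := Set.Finite.exists_le_minimal (Set.toFinite (Set.univ : Set α)) (Set.mem_univ a)
  exact ⟨t, fun x => (ht.2 (Set.mem_univ (t ⊓ x)) inf_le_left).trans inf_le_right⟩

theorem sub_ji {δ : Type u} [Lattice δ] (h : ∀ x y : δ, x = y) (x : δ) : ¬ JoinIrred x := by
  rintro ⟨y, hy, -⟩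
  exact hy.lt.ne (h _ _)

theorem sub_mi {δ : Type u} [Lattice δ] (h : ∀ x y : δ, x = y) (x : δ) : ¬ MeetIrred x := by
  rintro ⟨y, hy, -⟩
  exact hy.lt.ne (h _ _)

theorem cd_match [Finite β] (h : CompatiblyDismantlable β) : ∃ P : β → β → Prop, IsMatch P ∧
    ∀ P', IsMatch P' → ∀ j m, P' j m → P j m := by
  cases h with
  | singleton _ h =>
    have hs : ∀ x y : β, x = y := by
      have := (Nat.card_eq_one_iff_unique.1 h).1
      exact fun x y => Subsingleton.elim x y
    refine ⟨fun _ _ => False, ⟨?_, ?_, ?_, ?_, ?_, ?_, ?_, ?_, ?_⟩, ?_⟩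
    any_goals (intros; contradiction)
    · intro j hj; exact (sub_ji hs _ hj).elim
    · intro j hj; exact (sub_mi hs _ hj).elim
    · intro P' hP' j m h'; exact sub_ji hs _ (hP'.ji h')
  | step _ κ hκ hu =>
    exact ⟨RelK κ, toMatch hκ, fun P' hP' j m h => relK_le hu hP' h⟩

theorem main_thm {β : Type u} [Lattice β] [Finite β] (h : CompatiblyDismantlable β) :
    ∀ P : β → β → Prop, IsMatch P → DInd P → UInd P →
    ∀ (γ : Type u) [Lattice γ] [Finite γ] (f : γ → β) (u v : β), Emb f u v → u ≤ v →
    CompatiblyDismantlable γ ∧ Good P f u v := by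
  induction h with
  | singleton β h =>
    intro P hP hD hU γ _ _ f u v e huv
    have hs : ∀ x y : β, x = y := by
      have := (Nat.card_eq_one_iff_unique.1 h).1
      exact fun x y => Subsingleton.elim x y
    have hs' : ∀ x y : γ, x = y := fun x y => e.inj (hs _ _)
    refine ⟨.singleton γ ?_, ?_⟩
    · obtain ⟨x, -⟩ := e.surj le_rfl huv
      exact Nat.card_eq_one_iff_unique.2 ⟨⟨hs'⟩, ⟨x⟩⟩
    · refine ⟨?_, ?_, ?_, ?_, ?_, ?_⟩
      · intro j m x h; exact (sub_ji hs _ (hP.ji h)).elim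
      · intro x h; exact (sub_ji hs' _ h).elim
      · intros; exact hs _ _
      · intro j m x h; exact (sub_ji hs _ (hP.ji h)).elim
      · intro x h; exact (sub_mi hs' _ h).elim
      · intros; exact hs _ _
  | step β κ hκ huniq j0 m0 hpp hup hdn κup hκup hκupuniq κdn hκdn hκdnuniq halpha halphainj
      halphasurj hbeta hbetainj hbetasurj ihup ihdn =>
    intro P hP hD hU
    have hPu : ∀ P', IsMatch P' → ∀ j m, P' j m → P j m := fun P' hP' j m h =>
      match_ge hP (toMatch hκ) (fun j m h => relK_le huniq hP h) (relK_le huniq hP' h)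
    have kP : ∀ j m, P j m → ∃ hj, (κ ⟨j, hj⟩).1 = m := fun j m h => relK_le huniq hP h
    have Pk : ∀ j, P j.1 (κ j).1 := fun j => hPu _ (toMatch hκ) _ _ ⟨j.2, rfl⟩
    obtain ⟨t, ht⟩ := ex_top j0
    obtain ⟨b, hb⟩ := ex_bot j0
    have mU := toMatch hκup
    have mD := toMatch hκdn
    have eU : Emb (Subtype.val : Set.Ici j0 → β) j0 t :=
      ⟨Iff.rfl, fun x => x.2, fun x => ht _, fun {a} h _ => ⟨⟨a, h⟩, rfl⟩⟩
    have eD : Emb (Subtype.val : Set.Iic m0 → β) b m0 :=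
      ⟨Iff.rfl, fun x => hb _, fun x => x.2, fun {a} _ h => ⟨⟨a, h⟩, rfl⟩⟩
    have aU : ∀ {j m}, P j m → ∀ h : j0 ≤ m,
        RelK κup ⟨j0 ⊔ j, Set.mem_Ici.mpr le_sup_left⟩ ⟨m, h⟩ := by
      intro j m h hm
      obtain ⟨hj, rfl⟩ := kP j m h
      obtain ⟨h1, h2⟩ := halpha ⟨j, hj⟩ hm
      exact ⟨h1, Subtype.ext h2⟩
    have aD : ∀ {j m}, P j m → ∀ h : j ≤ m0,
        RelK κdn ⟨j, h⟩ ⟨m0 ⊓ m, Set.mem_Iic.mpr inf_le_left⟩ := by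
      intro j m h hm
      obtain ⟨hj, rfl⟩ := kP j m h
      obtain ⟨h1, h2⟩ := hbeta ⟨j, hj⟩ hm
      exact ⟨h1, Subtype.ext h2⟩
    have GU : Good P (Subtype.val : Set.Ici j0 → β) j0 t := by
      refine ⟨?_, ?_, ?_, ?_, ?_, ?_⟩
      · intro j m x h h1 h2 h3
        have r := aU h h2
        have : x = ⟨j0 ⊔ j, Set.mem_Ici.mpr le_sup_left⟩ := Subtype.ext h3
        subst this
        exact ⟨mU.ji r, fun y hy => mU.lo r hy⟩
      · intro x hx
        obtain ⟨j, h1, h2⟩ := halphasurj ⟨x, hx⟩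
        exact ⟨j.1, _, Pk j, ht _, h1, h2.symm⟩
      · intro j m j' m' h h' _ h1 _ h1' eq
        obtain ⟨hj, rfl⟩ := kP j m h
        obtain ⟨hj', rfl⟩ := kP j' m' h'
        exact congrArg Subtype.val (halphainj ⟨j, hj⟩ ⟨j', hj'⟩ h1 h1' eq)
      · intro j m x h h1 h2 h3
        have r := aU h h2
        rw [inf_eq_right.2 (ht m)] at h3
        have : x = ⟨m, h2⟩ := Subtype.ext h3
        subst this
        exact ⟨mU.mi r, fun y hy => le_sup_right.trans (mU.hi r hy : j0 ⊔ j ≤ y.1)⟩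
      · intro x hx
        obtain ⟨a, ha⟩ := mU.exj hx
        obtain ⟨j, h1, h2⟩ := halphasurj ⟨a, mU.ji ha⟩
        have r := aU (Pk j) h1
        have : a = ⟨j0 ⊔ j.1, Set.mem_Ici.mpr le_sup_left⟩ := Subtype.ext h2.symm
        subst this
        refine ⟨j.1, _, Pk j, ht _, h1, ?_⟩
        rw [inf_eq_right.2 (ht _), mU.um ha r]
      · intro j m j' m' h h' _ h1 _ h1' eq
        rwa [inf_eq_right.2 (ht _), inf_eq_right.2 (ht _)] at eq
    have GD : Good P (Subtype.val : Set.Iic m0 → β) b m0 := by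
      refine ⟨?_, ?_, ?_, ?_, ?_, ?_⟩
      · intro j m x h h1 h2 h3
        have r := aD h h1
        rw [sup_eq_right.2 (hb j)] at h3
        have : x = ⟨j, h1⟩ := Subtype.ext h3
        subst this
        exact ⟨mD.ji r, fun y hy => le_trans (show y.1 ≤ m0 ⊓ m from mD.lo r hy) inf_le_right⟩
      · intro x hx
        obtain ⟨a, ha⟩ := mD.exm hx
        obtain ⟨j, h1, h2⟩ := hbetasurj ⟨a, mD.mi ha⟩
        have r := aD (Pk j) h1
        have : a = ⟨m0 ⊓ (κ j).1, Set.mem_Iic.mpr inf_le_left⟩ := Subtype.ext h2.symm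
        subst this
        refine ⟨j.1, _, Pk j, h1, hb _, ?_⟩
        rw [sup_eq_right.2 (hb _), mD.uj ha r]
      · intro j m j' m' h h' _ h1 _ h1' eq
        rwa [sup_eq_right.2 (hb _), sup_eq_right.2 (hb _)] at eq
      · intro j m x h h1 h2 h3
        have r := aD h h1
        have : x = ⟨m0 ⊓ m, Set.mem_Iic.mpr inf_le_left⟩ := Subtype.ext h3
        subst this
        exact ⟨mD.mi r, fun y hy => mD.hi r hy⟩
      · intro x hx
        obtain ⟨j, h1, h2⟩ := hbetasurj ⟨x, hx⟩
        exact ⟨j.1, _, Pk j, h1, hb _, h2.symm⟩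
      · intro j m j' m' h h' h1 _ h1' _ eq
        obtain ⟨hj, rfl⟩ := kP j m h
        obtain ⟨hj', rfl⟩ := kP j' m' h'
        rw [hbetainj ⟨j, hj⟩ ⟨j', hj'⟩ h1 h1' eq]
    -- intervals inside the upper part
    have IU : ∀ (γ : Type u) [Lattice γ] [Finite γ] (f : γ → β) (u v : β), Emb f u v → u ≤ v →
        j0 ≤ u → CompatiblyDismantlable γ ∧ Good P f u v := by
      intro γ _ _ f u v e huv hu
      let f' : γ → Set.Ici j0 := fun x => ⟨f x, hu.trans (e.lo x)⟩
      have e' : Emb f' ⟨u, hu⟩ ⟨v, hu.trans huv⟩ := by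
        refine ⟨e.le, e.lo, e.hi, ?_⟩
        intro a h1 h2
        obtain ⟨x, hx⟩ := e.surj (a := a.1) h1 h2
        exact ⟨x, Subtype.ext hx⟩
      obtain ⟨r1, r2⟩ := ihup _ (GU.isMatch hP (ht _) eU) (Good.dInd hD eU) (Good.uInd hU eU)
        γ f' _ _ e' huv
      exact ⟨r1, Good.comp (ht _) eU GU r2⟩
    have ID : ∀ (γ : Type u) [Lattice γ] [Finite γ] (f : γ → β) (u v : β), Emb f u v → u ≤ v →
        v ≤ m0 → CompatiblyDismantlable γ ∧ Good P f u v := by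
      intro γ _ _ f u v e huv hv
      let f' : γ → Set.Iic m0 := fun x => ⟨f x, (e.hi x).trans hv⟩
      have e' : Emb f' ⟨u, huv.trans hv⟩ ⟨v, hv⟩ := by
        refine ⟨e.le, e.lo, e.hi, ?_⟩
        intro a h1 h2
        obtain ⟨x, hx⟩ := e.surj (a := a.1) h1 h2
        exact ⟨x, Subtype.ext hx⟩
      obtain ⟨r1, r2⟩ := ihdn _ (GD.isMatch hP (hb _) eD) (Good.dInd hD eD) (Good.uInd hU eD)
        γ f' _ _ e' huv
      exact ⟨r1, Good.comp (hb _) eD GD r2⟩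
    intro γ _ _ f u v e huv
    by_cases hu : j0 ≤ u
    · exact IU γ f u v e huv hu
    by_cases hv : v ≤ m0
    · exact ID γ f u v e huv hv
    have hu0 : u ≤ m0 := (hpp u).1.resolve_right hu
    have hv0 : j0 ≤ v := (hpp v).1.resolve_left hv
    have h0 := prime_rel hP hpp
    obtain ⟨j0', hj0⟩ := e.surj (a := u ⊔ j0) le_sup_left (sup_le huv hv0)
    obtain ⟨m0', hm0⟩ := e.surj (a := v ⊓ m0) (le_inf huv hu0) inf_le_left
    have eu := embUp e hj0
    have ed := embDn e hm0
    have le1 : u ⊔ j0 ≤ v := sup_le huv hv0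
    have le2 : u ≤ v ⊓ m0 := le_inf huv hu0
    obtain ⟨cU, gU⟩ := IU _ _ _ _ eu le1 le_sup_right
    obtain ⟨cD, gD⟩ := ID _ _ _ _ ed le2 inf_le_right
    have g := straddle hP hD hU hpp h0 huv e hu0 hv0 hj0 hm0 gU gD
    refine ⟨?_, g⟩
    have mu : ∀ {x}, j0' ≤ x ↔ j0 ≤ f x := by
      intro x
      rw [← e.le, hj0]
      exact ⟨fun h => le_sup_right.trans h, fun h => sup_le (e.lo _) h⟩
    have md : ∀ {x}, x ≤ m0' ↔ f x ≤ m0 := by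
      intro x
      rw [← e.le, hm0]
      exact ⟨fun h => h.trans inf_le_right, fun h => le_inf (e.hi _) h⟩
    have sj : ∀ {x : γ} {j}, f x = u ⊔ j → f (j0' ⊔ x) = (u ⊔ j0) ⊔ j := by
      intro x j h
      rw [e.sup, hj0, h, sup_sup_sup_comm, sup_idem, sup_assoc]
    have sm : ∀ {x : γ} {j}, f x = v ⊓ j → f (m0' ⊓ x) = (v ⊓ m0) ⊓ j := by
      intro x j h
      rw [e.inf, hm0, h, inf_inf_inf_comm, inf_idem, inf_assoc]
    refine cd_step (g.isMatch hP huv e) (g.uniq hP hPu huv e) j0' m0' ?_ cU cD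
      (gU.isMatch hP le1 eu) (gU.uniq hP hPu le1 eu) (gD.isMatch hP le2 ed)
      (gD.uniq hP hPu le2 ed) ?_ ?_ ?_ ?_ ?_ ?_
    · intro z
      rw [mu, md]; exact hpp _
    · rintro x y ⟨j, m, h, h1, h2, h3, h4⟩ hy
      have hm : j0 ≤ m := (mu.1 hy).trans (h4.le.trans inf_le_right)
      exact ⟨j, m, h, h1, sup_le h2 hm, sj h3, h4⟩
    · rintro x y x' y' ⟨j, m, h, h1, h2, h3, h4⟩ ⟨j', m', h', h1', h2', h3', h4'⟩ hy hy' eq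
      have hm : j0 ≤ m := (mu.1 hy).trans (h4.le.trans inf_le_right)
      have hm' : j0 ≤ m' := (mu.1 hy').trans (h4'.le.trans inf_le_right)
      obtain rfl := gU.J3 h h' h1 (sup_le h2 hm) h1' (sup_le h2' hm')
        ((sj h3).symm.trans ((congrArg f eq).trans (sj h3')))
      exact e.inj (h3.trans h3'.symm)
    · intro x hx
      obtain ⟨j, m, h, h1, h2, h3⟩ := gU.J2 hx
      have h2' := le_sup_left.trans h2
      obtain ⟨a, ha⟩ := e.surj le_sup_left (sup_le huv h1)
      obtain ⟨c, hc⟩ := e.surj (le_inf huv h2') inf_le_left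
      refine ⟨a, c, ⟨j, m, h, h1, h2', ha, hc⟩, ?_, ?_⟩
      · rw [mu, hc]; exact le_inf hv0 (le_sup_right.trans h2)
      · exact e.inj ((sj ha).trans h3.symm)
    · rintro x y ⟨j, m, h, h1, h2, h3, h4⟩ hy
      have hm : j ≤ m0 := (le_sup_right.trans h3.ge).trans (md.1 hy)
      exact ⟨j, m, h, le_inf h1 hm, h2, h3, sm h4⟩
    · rintro x y x' y' ⟨j, m, h, h1, h2, h3, h4⟩ ⟨j', m', h', h1', h2', h3', h4'⟩ hy hy' eq
      have hm : j ≤ m0 := (le_sup_right.trans h3.ge).trans (md.1 hy)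
      have hm' : j' ≤ m0 := (le_sup_right.trans h3'.ge).trans (md.1 hy')
      obtain rfl := gD.M3 h h' (le_inf h1 hm) h2 (le_inf h1' hm') h2'
        ((sm h4).symm.trans ((congrArg f eq).trans (sm h4')))
      obtain rfl := hP.uj h h'
      exact e.inj (h3.trans h3'.symm)
    · intro x hx
      obtain ⟨j, m, h, h1, h2, h3⟩ := gD.M2 hx
      have h1' := h1.trans inf_le_left
      obtain ⟨a, ha⟩ := e.surj le_sup_left (sup_le huv h1')
      obtain ⟨c, hc⟩ := e.surj (le_inf huv h2) inf_le_left
      refine ⟨a, c, ⟨j, m, h, h1', h2, ha, hc⟩, ?_, ?_⟩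
      · rw [md, ha]; exact sup_le hu0 (h1.trans inf_le_right)
      · exact e.inj ((sm hc).trans h3.symm)

end Helpers

/-- every interval of a finite semidistrim lattice is semidistrim. -/
theorem stmt15 {α : Type u} [Lattice α] [Finite α]
    (hsd : Semidistrim α) (u v : α) (huv : u ≤ v) :
    Semidistrim ↥(Set.Icc u v) := by
  obtain ⟨hc, hi⟩ := hsd
  obtain ⟨P, hP, hu⟩ := cd_match hc
  obtain ⟨κ, k1, k2⟩ := ofMatch hP
  have kk : ∀ {j m}, P j m → ∃ hj : JoinIrred j, (κ ⟨j, hj⟩).1 = m := fun {j m} h =>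
    ⟨hP.ji h, hP.um (k2 _) h⟩
  have hD : DInd P := by
    intro x y y' j m j' m' h h' c c' l l' r r' ne
    obtain ⟨hj, rfl⟩ := kk h
    obtain ⟨hj', rfl⟩ := kk h'
    have := (hi κ k1 x).1 ⟨j, hj⟩ ⟨y, c, l, r⟩ ⟨j', hj'⟩ ⟨y', c', l', r'⟩
    by_contra hn
    exact this ⟨fun h => ne (congrArg Subtype.val h), hn⟩
  have hU : UInd P := by
    intro x y y' j m j' m' h h' c c' l l' r r' ne
    obtain ⟨hj, rfl⟩ := kk h
    obtain ⟨hj', rfl⟩ := kk h'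
    have := (hi κ k1 x).2 ⟨j, hj⟩ ⟨y, c, l, r⟩ ⟨j', hj'⟩ ⟨y', c', l', r'⟩
    by_contra hn
    exact this ⟨fun h => ne (congrArg Subtype.val h), hn⟩
  have e : Emb (Subtype.val : Set.Icc u v → α) u v :=
    ⟨Iff.rfl, fun x => x.2.1, fun x => x.2.2, fun {a} h h' => ⟨⟨a, h, h'⟩, rfl⟩⟩
  obtain ⟨r1, g⟩ := main_thm hc P hP hD hU _ _ u v e huv
  refine ⟨r1, fun κ' hκ' x => ?_⟩
  have q : ∀ j, IndQ P (Subtype.val : Set.Icc u v → α) u v j.1 (κ' j).1 := fun j =>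
    g.uniq hP hu huv e _ (toMatch hκ') _ _ ⟨j.2, rfl⟩
  constructor
  · rintro j ⟨y, c, l, r⟩ j' ⟨y', c', l', r'⟩ ⟨ne, hn⟩
    exact hn (Good.dInd hD e (q j) (q j') c c' l l' r r' fun h => ne (Subtype.ext h))
  · rintro j ⟨y, c, l, r⟩ j' ⟨y', c', l', r'⟩ ⟨ne, hn⟩
    exact hn (Good.uInd hU e (q j) (q j') c c' l l' r r' fun h => ne (Subtype.ext h))
end

section
/- Every finite semidistrim lattice L is crosscut simplicial: for every interval [u, v] of L and every proper subset A of the set of atoms of [u, v] (the elements of [u, v] covering u), the join of A taken inside [u, v] (that is, u ∨ ⋁A) is not equal to v. -/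
universe u

theorem cd_label {β : Type u} [Lattice β] [Finite β] (h : CompatiblyDismantlable β) :
    ∀ κ : {j : β // JoinIrred j} → {m : β // MeetIrred m}, IsPairing κ →
      ∀ x y : β, x ⋖ y → ∃ j : {j : β // JoinIrred j}, j.1 ≤ y ∧ x ≤ (κ j).1 := by
  induction h with
  | singleton β h =>
    intro κ _ x y hxy
    have := (Nat.card_eq_one_iff_unique.mp h).1
    exact absurd (Subsingleton.elim x y) hxy.ne
  | step β κ hκ huniq j0 m0 hpp hup hdn κup hκup hκupuniq κdn hκdn hκdnuniq halpha halphainj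
      halphasurj hbeta hbetainj hbetasurj ihup ihdn =>
    intro κ' hκ' x y hxy
    obtain rfl := huniq κ' hκ'
    rcases (hpp x).1 with hx | hx
    · rcases (hpp y).1 with hy | hy
      · have hc : (⟨x, hx⟩ : ↥(Set.Iic m0)) ⋖ ⟨y, hy⟩ := by
          refine ⟨hxy.1, ?_⟩
          intro c h1 h2
          exact hxy.2 (c := c.1) h1 h2
        obtain ⟨j', h1, h2⟩ := ihdn κdn hκdn _ _ hc
        obtain ⟨j, hj, hj'⟩ := hbetasurj (κdn j')
        obtain ⟨hji, hk⟩ := hbeta j hj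
        have e : (⟨⟨j.1, Set.mem_Iic.mpr hj⟩, hji⟩ : {j : ↥(Set.Iic m0) // JoinIrred j}) = j' := by
          apply hκdn.1.1
          apply Subtype.ext
          apply Subtype.ext
          rw [hk, hj']
        subst e
        refine ⟨j, h1, ?_⟩
        have h3 : x ≤ m0 ⊓ (κ' j).1 := by
          rw [hj']; exact h2
        exact h3.trans inf_le_right
      · have hlt : ∀ z, z < j0 → z ≤ m0 := fun z hz =>
          (hpp z).1.resolve_right (fun h => absurd hz h.not_gt)
        have hnot : ¬ j0 ≤ m0 := fun h => (hpp j0).2 ⟨h, le_rfl⟩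
        have hcov : m0 ⊓ j0 ⋖ j0 := by
          refine ⟨lt_of_le_of_ne inf_le_right (fun h => hnot (h ▸ inf_le_left)), ?_⟩
          intro c h1 h2
          exact absurd (le_inf (hlt c h2) h2.le) h1.not_ge
        have hj0 : JoinIrred j0 := by
          refine ⟨m0 ⊓ j0, hcov, ?_⟩
          intro z hz
          by_contra hne
          exact hz.2 (lt_of_le_of_ne (le_inf (hlt z hz.1) hz.1.le) hne) hcov.1
        have hmax := hκ.2.1 ⟨j0, hj0⟩ _ hcov
        have hle : (κ' ⟨j0, hj0⟩).1 ≤ m0 := by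
          refine (hpp _).1.resolve_right (fun h => ?_)
          have h1 : j0 ⊓ (κ' ⟨j0, hj0⟩).1 = m0 ⊓ j0 := hmax.1
          rw [inf_eq_left.mpr h] at h1
          exact hcov.1.ne h1.symm
        exact ⟨⟨j0, hj0⟩, hy, hx.trans (hmax.2 (y := m0) (inf_comm _ _) hle)⟩
    · have hy : j0 ≤ y := hx.trans hxy.1.le
      have hc : (⟨x, hx⟩ : ↥(Set.Ici j0)) ⋖ ⟨y, hy⟩ := by
        refine ⟨hxy.1, ?_⟩
        intro c h1 h2
        exact hxy.2 (c := c.1) h1 h2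
      obtain ⟨j', h1, h2⟩ := ihup κup hκup _ _ hc
      obtain ⟨j, hj, hj'⟩ := halphasurj j'
      obtain ⟨hji, hk⟩ := halpha j hj
      have e : (⟨⟨j0 ⊔ j.1, Set.mem_Ici.mpr le_sup_left⟩, hji⟩ :
          {j : ↥(Set.Ici j0) // JoinIrred j}) = j' := by
        apply Subtype.ext
        apply Subtype.ext
        exact hj'
      subst e
      refine ⟨j, le_trans le_sup_right (show j0 ⊔ j.1 ≤ y from h1), ?_⟩
      rw [← hk]; exact h2

theorem cd_pairing {β : Type u} [Lattice β] [Finite β] (h : CompatiblyDismantlable β)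
    (x y : β) (hxy : x ⋖ y) :
    ∃ κ : {j : β // JoinIrred j} → {m : β // MeetIrred m}, IsPairing κ := by
  cases h with
  | singleton _ h =>
    have := (Nat.card_eq_one_iff_unique.mp h).1
    exact absurd (Subsingleton.elim x y) hxy.ne
  | step _ κ hκ => exact ⟨κ, hκ⟩

theorem pairing_not_le {β : Type u} [Lattice β]
    {κ : {j : β // JoinIrred j} → {m : β // MeetIrred m}} (hκ : IsPairing κ)
    (j : {j : β // JoinIrred j}) : ¬ j.1 ≤ (κ j).1 := by
  intro h
  obtain ⟨s, hs, _⟩ := j.2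
  have h1 : j.1 ⊓ (κ j).1 = s := (hκ.2.1 j s hs).1
  rw [inf_eq_left.mpr h] at h1
  exact hs.1.ne h1.symm

theorem label_sup {β : Type u} [Lattice β]
    {κ : {j : β // JoinIrred j} → {m : β // MeetIrred m}} (hκ : IsPairing κ)
    (j : {j : β // JoinIrred j}) {x y : β} (hxy : x ⋖ y) (h1 : j.1 ≤ y) (h2 : x ≤ (κ j).1) :
    x ⊔ j.1 = y := by
  by_contra hne
  refine hxy.2 (c := x ⊔ j.1) (lt_of_le_of_ne le_sup_left ?_)
    (lt_of_le_of_ne (sup_le hxy.1.le h1) hne)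
  intro h
  refine pairing_not_le hκ j (le_trans ?_ h2)
  rw [h]; exact le_sup_right

/-- semidistrim lattices are crosscut simplicial: for every interval
`[u, v]` and every proper subset `A` of the atoms of `[u, v]`, the join `u ⊔ ⋁ A`
(computed in `[u, v]`) is not `v`. -/
theorem stmt16 {α : Type u} [CompleteLattice α] [Finite α]
    (hsd : Semidistrim α) (u v : α) (huv : u ≤ v)
    (A : Set α) (hA : A ⊂ {a : α | u ⋖ a ∧ a ≤ v}) :
    u ⊔ sSup A ≠ v := by
  intro heq
  obtain ⟨hsub, hns⟩ := hA
  obtain ⟨a, ha, haA⟩ := Set.not_subset.mp hns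
  obtain ⟨κ, hκ⟩ := cd_pairing hsd.1 u a ha.1
  obtain ⟨j, hj1, hj2⟩ := cd_label hsd.1 κ hκ u a ha.1
  refine pairing_not_le hκ j ((hj1.trans ha.2).trans ?_)
  rw [← heq]
  refine sup_le hj2 (sSup_le ?_)
  intro b hb
  have hub := (hsub hb).1
  obtain ⟨i, hi1, hi2⟩ := cd_label hsd.1 κ hκ u b hub
  have hib := label_sup hκ i hub hi1 hi2
  have hne : i ≠ j := by
    rintro rfl
    exact haA ((label_sup hκ i ha.1 hj1 hj2).symm.trans hib ▸ hb)
  rw [← hib]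
  refine sup_le hj2 ?_
  by_contra hn
  exact (hsd.2 κ hκ u).2 i ⟨b, hub, hi1, hi2⟩ j ⟨a, ha.1, hj1, hj2⟩ ⟨hne, hn⟩
end
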